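/- For any superboolean matrix A, the maximal number of independent columns equals the maximal number of independent rows, and both equal the maximal size k of a k×k nonsingular submatrix of A. -/

import Mathlib

open scoped Classical

/-- The superboolean semiring `SB = {0, 1, 1^ν}`. -/
def SB := Fin 3

instance : DecidableEq SB := inferInstanceAs (DecidableEq (Fin 3))
instance : Fintype SB := inferInstanceAs (Fintype (Fin 3))

def SB.zero : SB := (0 : Fin 3)
def SB.one : SB := (1 : Fin 3)
/-- The ghost element `1^ν`. -/
def SB.nu : SB := (2 : Fin 3)

def SB.val (a : SB) : ℕ := Fin.val a

instance : Zero SB := ⟨SB.zero⟩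
instance : One SB := ⟨SB.one⟩

def SB.add (a b : SB) : SB := (⟨min (a.val + b.val) 2, by omega⟩ : Fin 3)
def SB.mul (a b : SB) : SB := (⟨min (a.val * b.val) 2, by omega⟩ : Fin 3)

instance : Add SB := ⟨SB.add⟩
instance : Mul SB := ⟨SB.mul⟩

instance : AddCommMonoid SB where
  add := (· + ·)
  add_assoc := by decide
  zero_add := by decide
  add_zero := by decide
  add_comm := by decide
  nsmul := nsmulRec

instance : CommMonoid SB where
  mul := (· * ·)
  mul_assoc := by decide
  one_mul := by decide
  mul_one := by decide
  mul_comm := by decide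
  npow := npowRec

/-- The permanent of a square superboolean matrix. -/
def sbPer {n : ℕ} (A : Matrix (Fin n) (Fin n) SB) : SB :=
  ∑ π : Equiv.Perm (Fin n), ∏ i, A (π i) i

/-- A square superboolean matrix is nonsingular when its permanent is `1`. -/
def Nonsingular {n : ℕ} (A : Matrix (Fin n) (Fin n) SB) : Prop := sbPer A = SB.one

/-- Membership in the ghost ideal `{0, 1^ν}`. -/
def SB.IsGhost (a : SB) : Prop := a = SB.zero ∨ a = SB.nu

/-- A family of superboolean vectors is dependent if some nontrivial boolean
combination of them lies entirely in the ghost ideal. -/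
def SBDep {κ ι : Type*} [Fintype κ] (v : κ → ι → SB) : Prop :=
  ∃ α : κ → SB, (∀ k, α k = SB.zero ∨ α k = SB.one) ∧ (∃ k, α k ≠ SB.zero) ∧
    ∀ j : ι, SB.IsGhost (∑ k, α k * v k j)

/-- Independence of a family of superboolean vectors. -/
def SBIndep {κ ι : Type*} [Fintype κ] (v : κ → ι → SB) : Prop := ¬ SBDep v

/-- A matrix is boolean if none of its entries is the ghost `1^ν`. -/
def IsBooleanMat {ι κ : Type*} (A : Matrix ι κ SB) : Prop := ∀ i j, A i j ≠ SB.nu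

namespace SB

theorem isGhost_iff : ∀ a : SB, a.IsGhost ↔ a ≠ 1 := by
  intro a
  unfold IsGhost
  revert a
  decide

theorem zero_mul' : ∀ a : SB, 0 * a = 0 := by decide

theorem zero_ne_one' : (0 : SB) ≠ 1 := by decide

theorem add_eq_zero_iff' : ∀ a b : SB, a + b = 0 ↔ a = 0 ∧ b = 0 := by decide

theorem add_eq_one_iff' : ∀ a b : SB, a + b = 1 ↔ a = 1 ∧ b = 0 ∨ a = 0 ∧ b = 1 := by decide

theorem mul_eq_zero_iff' : ∀ a b : SB, a * b = 0 ↔ a = 0 ∨ b = 0 := by decide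

theorem mul_eq_one_iff' : ∀ a b : SB, a * b = 1 ↔ a = 1 ∧ b = 1 := by decide

variable {κ : Type*}

theorem sum_eq_zero_iff' (s : Finset κ) (a : κ → SB) :
    ∑ i ∈ s, a i = 0 ↔ ∀ i ∈ s, a i = 0 := by
  induction s using Finset.induction_on with
  | empty => simp
  | insert x s hx ih => rw [Finset.sum_insert hx, add_eq_zero_iff', ih]; simp

/-- A sum equals `1` exactly when one term is `1` and all others vanish. -/
theorem sum_eq_one_iff' (s : Finset κ) (a : κ → SB) :
    ∑ i ∈ s, a i = 1 ↔ ∃ i ∈ s, a i = 1 ∧ ∀ j ∈ s, j ≠ i → a j = 0 := by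
  induction s using Finset.induction_on with
  | empty => simpa using zero_ne_one'
  | insert x s hx ih =>
    rw [Finset.sum_insert hx, add_eq_one_iff', ih, sum_eq_zero_iff']
    constructor
    · rintro (⟨h1, h0⟩ | ⟨h0, i, hi, h1, h⟩)
      · refine ⟨x, by simp, h1, fun j hj hjx => h0 j ?_⟩
        simpa [hjx] using hj
      · refine ⟨i, by simp [hi], h1, fun j hj hji => ?_⟩
        rcases Finset.mem_insert.1 hj with rfl | hj
        · exact h0
        · exact h j hj hji
    · rintro ⟨i, hi, h1, h⟩
      rcases Finset.mem_insert.1 hi with rfl | hi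
      · exact Or.inl ⟨h1, fun j hj => h j (by simp [hj]) (by rintro rfl; exact hx hj)⟩
      · exact Or.inr ⟨h x (by simp) (by rintro rfl; exact hx hi), i, hi, h1,
          fun j hj => h j (by simp [hj])⟩

theorem prod_eq_zero_iff' (s : Finset κ) (a : κ → SB) :
    ∏ i ∈ s, a i = 0 ↔ ∃ i ∈ s, a i = 0 := by
  induction s using Finset.induction_on with
  | empty => simpa using zero_ne_one'.symm
  | insert x s hx ih => rw [Finset.prod_insert hx, mul_eq_zero_iff', ih]; simp

theorem prod_eq_one_iff' (s : Finset κ) (a : κ → SB) :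
    ∏ i ∈ s, a i = 1 ↔ ∀ i ∈ s, a i = 1 := by
  induction s using Finset.induction_on with
  | empty => simp
  | insert x s hx ih => rw [Finset.prod_insert hx, mul_eq_one_iff', ih]; simp

end SB

section

variable {κ ι : Type*}

/-- A family is independent exactly when every nonempty subfamily has a coordinate at which
one member is `1` and the others vanish. -/
theorem sbIndep_iff [Fintype κ] (v : κ → ι → SB) :
    SBIndep v ↔ ∀ J : Finset κ, J.Nonempty →
      ∃ j, ∃ k ∈ J, v k j = 1 ∧ ∀ l ∈ J, l ≠ k → v l j = 0 := by
  have hsum (J : Finset κ) (α : κ → SB) (hα : ∀ k, α k = if k ∈ J then 1 else 0) (j : ι) :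
      ∑ k, α k * v k j = ∑ k ∈ J, v k j := by
    have hterm (k : κ) : α k * v k j = if k ∈ J then v k j else 0 := by
      rw [hα]
      split_ifs
      · exact one_mul _
      · exact SB.zero_mul' _
    simp only [hterm, Finset.sum_ite_mem, Finset.univ_inter]
  constructor
  · intro h J hJ
    by_contra hcon
    refine h ⟨fun k => if k ∈ J then 1 else 0, fun k => ?_, ?_, fun j => ?_⟩
    · by_cases hk : k ∈ J
      · exact Or.inr (if_pos hk)
      · exact Or.inl (if_neg hk)
    · obtain ⟨k, hk⟩ := hJ
      refine ⟨k, ?_⟩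
      simp only [hk, if_true]
      exact SB.zero_ne_one'.symm
    · rw [SB.isGhost_iff, hsum J _ (fun _ => rfl) j]
      exact fun hone => hcon ⟨j, (SB.sum_eq_one_iff' J _).1 hone⟩
  · rintro h ⟨α, hα, ⟨k, hk⟩, hghost⟩
    let J : Finset κ := Finset.univ.filter fun k => α k ≠ 0
    obtain ⟨j, hj⟩ := h J ⟨k, Finset.mem_filter.2 ⟨Finset.mem_univ k, hk⟩⟩
    have hαJ (k : κ) : α k = if k ∈ J then 1 else 0 := by
      by_cases hk : α k = 0
      · simp [J, hk]
      · simpa [J, hk] using show α k = 1 from (hα k).resolve_left hk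
    refine (SB.isGhost_iff _).1 (hghost j) ?_
    rw [hsum J α hαJ j]
    exact (SB.sum_eq_one_iff' J _).2 hj

/-- Exactly one perfect matching of the nonzero entries exists, and all its entries are `1`. -/
def HasUniqueMatching (M : κ → κ → SB) : Prop :=
  ∃ π : Equiv.Perm κ, (∀ i, M i (π i) = 1) ∧
    ∀ ρ : Equiv.Perm κ, (∀ i, M i (ρ i) ≠ 0) → ρ = π

theorem HasUniqueMatching.swap {M : κ → κ → SB} (h : HasUniqueMatching M) :
    HasUniqueMatching fun i j => M j i := by
  obtain ⟨π, h1, hu⟩ := h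
  refine ⟨π.symm, fun i => by simpa using h1 (π.symm i), fun ρ hρ => ?_⟩
  rw [← hu ρ.symm fun i => by simpa using hρ (ρ.symm i), Equiv.symm_symm]

/-- Independent vectors admit a triangular arrangement of coordinates, described by a rank
function `d`. -/
theorem exists_triangular (v : κ → ι → SB)
    (h : ∀ J : Finset κ, J.Nonempty → ∃ j, ∃ k ∈ J, v k j = 1 ∧ ∀ l ∈ J, l ≠ k → v l j = 0)
    (hι : Nonempty ι) (J : Finset κ) :
    ∃ (f : κ → ι) (d : κ → ℕ), ∀ s ∈ J, v s (f s) = 1 ∧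
      ∀ t ∈ J, t ≠ s → d s ≤ d t → v t (f s) = 0 := by
  induction J using Finset.strongInduction with
  | H J ih =>
    rcases J.eq_empty_or_nonempty with rfl | hJ
    · exact ⟨fun _ => hι.some, fun _ => 0, by simp⟩
    obtain ⟨j, k, hk, h1, h0⟩ := h J hJ
    obtain ⟨f, d, hfd⟩ := ih (J.erase k) (Finset.erase_ssubset hk)
    refine ⟨fun s => if s = k then j else f s, fun s => if s = k then 0 else d s + 1, ?_⟩
    intro s hs
    by_cases hsk : s = k
    · subst hsk
      simp only [if_true]
      exact ⟨h1, fun t ht hts _ => h0 t ht hts⟩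
    · have hs' := hfd s (Finset.mem_erase.2 ⟨hsk, hs⟩)
      simp only [hsk, if_false]
      refine ⟨hs'.1, fun t ht hts hd => ?_⟩
      by_cases htk : t = k
      · simp [htk] at hd
      · simp only [htk, if_false] at hd
        exact hs'.2 t (Finset.mem_erase.2 ⟨htk, ht⟩) hts (by omega)

theorem SBIndep.exists_hasUniqueMatching [Fintype κ] {v : κ → ι → SB} (hv : SBIndep v) :
    ∃ f : κ → ι, Function.Injective f ∧ HasUniqueMatching fun i j => v i (f j) := by
  rw [sbIndep_iff] at hv
  rcases isEmpty_or_nonempty κ with hκ | ⟨⟨k⟩⟩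
  · exact ⟨hκ.elim, fun i => hκ.elim i, 1, fun i => hκ.elim i, fun _ _ => Subsingleton.elim _ _⟩
  obtain ⟨j, -⟩ := hv {k} (by simp)
  obtain ⟨f, d, hfd⟩ := exists_triangular v hv ⟨j⟩ Finset.univ
  have h1 (s : κ) : v s (f s) = 1 := (hfd s (Finset.mem_univ s)).1
  have h0 (s t : κ) (hts : t ≠ s) (hd : d s ≤ d t) : v t (f s) = 0 :=
    (hfd s (Finset.mem_univ s)).2 t (Finset.mem_univ t) hts hd
  refine ⟨f, fun s t hst => ?_, 1, h1, fun ρ hρ => ?_⟩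
  · by_contra hne
    rcases le_total (d s) (d t) with hd | hd
    · have := h0 s t (Ne.symm hne) hd
      rw [hst, h1] at this
      exact SB.zero_ne_one' this.symm
    · have := h0 t s hne hd
      rw [← hst, h1] at this
      exact SB.zero_ne_one' this.symm
  · have hlt (i : κ) (hi : ρ i ≠ i) : d i < d (ρ i) := by
      by_contra hcon
      exact hρ i (h0 (ρ i) i (Ne.symm hi) (not_lt.1 hcon))
    have hle (i : κ) : d i ≤ d (ρ i) := by
      by_cases hi : ρ i = i
      · rw [hi]
      · exact (hlt i hi).le
    have hsum : ∑ i, d i = ∑ i, d (ρ i) := (Equiv.sum_comp ρ d).symm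
    have heq := (Finset.sum_eq_sum_iff_of_le fun i _ => hle i).1 hsum
    ext i
    by_contra hi
    exact (hlt i hi).ne (heq i (Finset.mem_univ i))

/-- A self-map of a finite type without fixed points on a nonempty invariant set agrees with some
nontrivial permutation at every point which that permutation moves. -/
theorem exists_perm_ne_one_of_map [Finite κ] {σ : κ → κ} {J : Set κ} (hJ : J.Nonempty)
    (hmaps : Set.MapsTo σ J J) (hne : ∀ j ∈ J, σ j ≠ j) :
    ∃ τ : Equiv.Perm κ, τ ≠ 1 ∧ ∀ j, τ j = j ∨ τ j = σ j := by
  let τ : κ → κ := fun j => if j ∈ Function.periodicPts σ then σ j else j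
  have hbij := Function.bijOn_periodicPts σ
  have hτ : Function.Injective τ := by
    intro a b hab
    by_cases ha : a ∈ Function.periodicPts σ <;> by_cases hb : b ∈ Function.periodicPts σ <;>
      simp only [τ, ha, hb, if_true, if_false] at hab
    · exact hbij.injOn ha hb hab
    · exact absurd (hab ▸ hbij.mapsTo ha) hb
    · exact absurd (hab ▸ hbij.mapsTo hb) ha
    · exact hab
  refine ⟨Equiv.ofBijective τ (Finite.injective_iff_bijective.1 hτ), fun h => ?_, fun j => ?_⟩
  · obtain ⟨x, hx⟩ := hJ
    obtain ⟨m, n, hmn, heq⟩ : ∃ m n : ℕ, m < n ∧ σ^[m] x = σ^[n] x := by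
      obtain ⟨m, n, hmn, heq⟩ := Finite.exists_ne_map_eq_of_infinite fun n : ℕ => σ^[n] x
      rcases hmn.lt_or_gt with hlt | hlt
      · exact ⟨m, n, hlt, heq⟩
      · exact ⟨n, m, hlt, heq.symm⟩
    have hper : σ^[m] x ∈ Function.periodicPts σ := by
      refine Function.mk_mem_periodicPts (n := n - m) (by omega) ?_
      rw [Function.IsPeriodicPt, Function.IsFixedPt, ← Function.iterate_add_apply,
        Nat.sub_add_cancel hmn.le, heq]
    have hfix : τ (σ^[m] x) = σ^[m] x := congrArg (fun ρ : Equiv.Perm κ => ρ (σ^[m] x)) h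
    simp only [τ, hper, if_true] at hfix
    exact hne _ (hmaps.iterate m hx) hfix
  · by_cases hj : j ∈ Function.periodicPts σ
    · exact Or.inr (by simp [τ, hj])
    · exact Or.inl (by simp [τ, hj])

theorem HasUniqueMatching.sbIndep [Fintype κ] {M : κ → κ → SB} (hM : HasUniqueMatching M) : SBIndep M := by
  obtain ⟨π, h1, hu⟩ := hM
  rw [sbIndep_iff]
  intro J hJ
  by_contra! hcon
  have hstep (k : κ) : ∃ l, k ∈ J → l ∈ J ∧ l ≠ k ∧ M l (π k) ≠ 0 := by
    by_cases hk : k ∈ J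
    · obtain ⟨l, hl⟩ := hcon (π k) k hk (h1 k)
      exact ⟨l, fun _ => hl⟩
    · exact ⟨k, fun h => absurd h hk⟩
  choose σ hσ using hstep
  let σ' : κ → κ := fun k => if k ∈ J then σ k else k
  have hσ' (k : κ) (hk : k ∈ J) : σ' k = σ k := if_pos hk
  obtain ⟨τ, hτ1, hτ⟩ := exists_perm_ne_one_of_map (σ := σ') (J := (J : Set κ)) hJ
    (fun k hk => by rw [hσ' k hk]; exact (hσ k hk).1)
    (fun k hk => by rw [hσ' k hk]; exact (hσ k hk).2.1)
  have hnz (k : κ) : M (τ k) (π k) ≠ 0 := by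
    have hone : M k (π k) ≠ 0 := by rw [h1]; exact SB.zero_ne_one'.symm
    rcases hτ k with h | h
    · rwa [h]
    · rw [h]
      by_cases hk : k ∈ J
      · rw [hσ' k hk]; exact (hσ k hk).2.2
      · rwa [show σ' k = k from if_neg hk]
  have hρ := hu (π * τ⁻¹) fun i => by simpa using hnz (τ⁻¹ i)
  exact hτ1 (inv_eq_one.1 (mul_eq_left.1 hρ))

end

theorem nonsingular_iff {k : ℕ} (A : Matrix (Fin k) (Fin k) SB) :
    Nonsingular A ↔ HasUniqueMatching fun i j => A j i := by
  change (∑ π : Equiv.Perm (Fin k), ∏ i, A (π i) i) = 1 ↔ _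
  rw [SB.sum_eq_one_iff']
  simp only [SB.prod_eq_one_iff', SB.prod_eq_zero_iff', Finset.mem_univ, true_and, true_imp_iff]
  refine exists_congr fun π => and_congr_right fun _ => forall_congr' fun ρ => ?_
  rw [← not_imp_not]
  simp

theorem Nonsingular.transpose {k : ℕ} {A : Matrix (Fin k) (Fin k) SB} (h : Nonsingular A) :
    Nonsingular fun i j => A j i :=
  (nonsingular_iff _).2 ((nonsingular_iff A).1 h).swap

theorem SBIndep.of_comp {κ ι ι' : Type*} [Fintype κ] {v : κ → ι → SB} (f : ι' → ι)
    (h : SBIndep fun k i => v k (f i)) : SBIndep v := by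
  rw [sbIndep_iff] at h ⊢
  intro J hJ
  obtain ⟨j, hj⟩ := h J hJ
  exact ⟨f j, hj⟩

theorem exists_indep_cols_iff {m n : ℕ} (A : Matrix (Fin m) (Fin n) SB) (k : ℕ) :
    (∃ g : Fin k → Fin n, Function.Injective g ∧ SBIndep (fun j (i : Fin m) => A i (g j))) ↔
      ∃ (f : Fin k → Fin m) (g : Fin k → Fin n), Function.Injective f ∧ Function.Injective g ∧
        Nonsingular (fun i j : Fin k => A (f i) (g j)) := by
  constructor
  · rintro ⟨g, hg, hind⟩
    obtain ⟨f, hf, hM⟩ := hind.exists_hasUniqueMatching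
    exact ⟨f, g, hf, hg, (nonsingular_iff _).2 hM⟩
  · rintro ⟨f, g, -, hg, hM⟩
    exact ⟨g, hg, ((nonsingular_iff _).1 hM).sbIndep.of_comp f⟩

theorem exists_indep_rows_iff {m n : ℕ} (A : Matrix (Fin m) (Fin n) SB) (k : ℕ) :
    (∃ f : Fin k → Fin m, Function.Injective f ∧ SBIndep (fun i (j : Fin n) => A (f i) j)) ↔
      ∃ (f : Fin k → Fin m) (g : Fin k → Fin n), Function.Injective f ∧ Function.Injective g ∧
        Nonsingular (fun i j : Fin k => A (f i) (g j)) := by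
  refine (exists_indep_cols_iff A.transpose k).trans ⟨?_, ?_⟩ <;>
  · rintro ⟨g, f, hg, hf, h⟩
    exact ⟨f, g, hf, hg, h.transpose⟩

/-- For any superboolean matrix, the maximal number of independent columns, the
maximal number of independent rows, and the maximal size of a nonsingular square
submatrix all coincide. -/
theorem row_rank_eq_col_rank_eq_submatrix_rank {m n : ℕ} (A : Matrix (Fin m) (Fin n) SB) :
    ∃ r : ℕ,
      IsGreatest {k : ℕ | ∃ g : Fin k → Fin n, Function.Injective g ∧
        SBIndep (fun j (i : Fin m) => A i (g j))} r ∧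
      IsGreatest {k : ℕ | ∃ f : Fin k → Fin m, Function.Injective f ∧
        SBIndep (fun i (j : Fin n) => A (f i) j)} r ∧
      IsGreatest {k : ℕ | ∃ (f : Fin k → Fin m) (g : Fin k → Fin n),
        Function.Injective f ∧ Function.Injective g ∧
        Nonsingular (fun i j : Fin k => A (f i) (g j))} r := by
  simp only [exists_indep_cols_iff, exists_indep_rows_iff, and_self]
  refine BddAbove.exists_isGreatest_of_nonempty ⟨n, ?_⟩ ⟨0, ?_⟩
  · rintro k ⟨-, g, -, hg, -⟩
    simpa using Fintype.card_le_of_injective g hg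
  · refine ⟨Fin.elim0, Fin.elim0, fun i => i.elim0, fun i => i.elim0, (nonsingular_iff _).2 ?_⟩
    exact ⟨1, fun i => i.elim0, fun _ _ => Subsingleton.elim _ _⟩
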